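/- Let r ≥ 3 be a natural number and let (b_n)_{n≥1} be a real sequence belonging to GM(β*, r) with witnessing constant c > 1. Suppose n·|b_n| → 0 as n → ∞ and ∑_{n=1}^∞ ∑_{k=1}^{⌊r/2⌋} |b_{r·n+k} − b_{r·n+r−k}| < ∞. Set ε_n^{(1)} := sup_{k ≥ n/c} k·|b_k|, ε_n^{(2)} := ∑_{m ≥ n/r} ∑_{k=1}^{⌊r/2⌋} |b_{r·m+k} − b_{r·m+r−k}|, and r_n(x) := ∑_{k=n}^∞ b_k sin(kx). Then there is a constant C > 0 (independent of n and x) such that |r_n(x)| ≤ C·(ε_n^{(1)} + ε_n^{(2)}) for all x ∈ ℝ and all n ≥ 1. -/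

import Mathlib

open Finset Filter

/-- A weight vanishing at `0` and odd under `j ↦ r - j` only sees the antisymmetric part of `d`. -/
lemma abs_sum_range_mul_le_of_antisymm (r : ℕ) (hr : 1 ≤ r) (d s : ℕ → ℝ) (s_zero : s 0 = 0)
    (s_le : ∀ j, |s j| ≤ 1) (s_anti : ∀ j ≤ r, s (r - j) = - s j) :
    |∑ j ∈ range r, d j * s j| ≤ ∑ j ∈ Icc 1 (r / 2), |d j - d (r - j)| := by
  have h1 : ∑ j ∈ range r, d j * s j = ∑ j ∈ Ico 1 r, d j * s j := by
    rw [range_eq_Ico, sum_eq_sum_Ico_succ_bot (by omega)]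
    simp [s_zero]
  have reflect (g : ℕ → ℝ) : ∑ j ∈ Ico 1 r, g (r - j) = ∑ j ∈ Ico 1 r, g j := by
    have := sum_Ico_reflect g 1 (m := r) (n := r) (by omega)
    rw [this]
    congr 2; omega
  have h2 : 2 * ∑ j ∈ Ico 1 r, d j * s j = ∑ j ∈ Ico 1 r, (d j - d (r - j)) * s j := by
    have h3 : ∑ j ∈ Ico 1 r, d (r - j) * s (r - j) = - ∑ j ∈ Ico 1 r, d (r - j) * s j := by
      rw [← sum_neg_distrib]
      refine sum_congr rfl fun j hj => ?_
      rw [s_anti j (by simp at hj; omega)]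
      ring
    have h4 := reflect fun j => d j * s j
    simp only [sub_mul, sum_sub_distrib]
    linarith
  have h5 : |∑ j ∈ Ico 1 r, (d j - d (r - j)) * s j| ≤ ∑ j ∈ Ico 1 r, |d j - d (r - j)| := by
    refine (abs_sum_le_sum_abs _ _).trans (sum_le_sum fun j _ => ?_)
    rw [abs_mul]
    exact mul_le_of_le_one_right (abs_nonneg _) (s_le j)
  have h6 : ∑ j ∈ Ico 1 r, |d j - d (r - j)| ≤ 2 * ∑ j ∈ Icc 1 (r / 2), |d j - d (r - j)| := by
    rw [← sum_Ico_consecutive (n := r / 2 + 1) _ (by omega) (by omega), two_mul]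
    refine add_le_add (le_of_eq ?_) ?_
    · congr 1
    · have h7 : ∑ j ∈ Ico (r / 2 + 1) r, |d j - d (r - j)| =
          ∑ j ∈ Ico 1 (r - r / 2), |d (r - j) - d j| := by
        have := sum_Ico_reflect (fun j => |d (r - j) - d j|) (r / 2 + 1) (m := r) (n := r) (by omega)
        have e : r + 1 - r = 1 := by omega
        have e' : r + 1 - (r / 2 + 1) = r - r / 2 := by omega
        rw [e, e'] at this
        rw [← this]
        refine sum_congr rfl fun j hj => ?_
        have : r - (r - j) = j := by simp at hj; omega
        rw [this]
      rw [h7]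
      simp only [abs_sub_comm (d (r - _))]
      exact sum_le_sum_of_subset_of_nonneg (fun j hj => by simp at hj ⊢; omega)
        fun _ _ _ => abs_nonneg _
  have h8 : |2 * ∑ j ∈ Ico 1 r, d j * s j| = 2 * |∑ j ∈ Ico 1 r, d j * s j| := by
    rw [abs_mul]; norm_num
  rw [h1]
  rw [h2] at h8
  linarith

lemma sum_Ico_mul_eq_sum_blocks (r p q : ℕ) (hpq : p ≤ q) (f : ℕ → ℝ) :
    ∑ k ∈ Ico (r * p) (r * q), f k = ∑ m ∈ Ico p q, ∑ j ∈ range r, f (r * m + j) := by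
  induction q, hpq using Nat.le_induction with
  | base => simp
  | succ q hpq ih =>
    rw [sum_Ico_succ_top hpq, ← ih,
      ← sum_Ico_consecutive f (Nat.mul_le_mul_left r hpq) (Nat.mul_le_mul_left r q.le_succ),
      sum_Ico_eq_sum_range f (r * q)]
    congr 3
    rw [Nat.mul_succ]; omega

lemma sum_range_sub_shift (f : ℕ → ℝ) (L r : ℕ) :
    ∑ i ∈ range L, (f i - f (i + r)) = ∑ i ∈ range r, (f i - f (L + i)) := by
  have h1 := sum_range_add f L r
  have h2 := sum_range_add f r L
  rw [Nat.add_comm] at h2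
  simp only [sum_sub_distrib]
  have : ∑ i ∈ range L, f (i + r) = ∑ i ∈ range L, f (r + i) :=
    sum_congr rfl fun i _ => by rw [Nat.add_comm]
  linarith

/-- A short sum of `b k * w k` with bounded weights is controlled by a bound on `k * |b k|`. -/
lemma abs_sum_Ico_mul_le_card (b w : ℕ → ℝ) (E : ℝ) (a M L : ℕ) (ha : 1 ≤ a) (hM : M ≤ a + L)
    (hE : 0 ≤ E) (hb : ∀ k, a ≤ k → (k : ℝ) * |b k| ≤ E) (w_le : ∀ k, |w k| ≤ 1) :
    |∑ k ∈ Ico a M, b k * w k| ≤ L * E := by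
  calc |∑ k ∈ Ico a M, b k * w k| ≤ ∑ k ∈ Ico a M, E := by
        refine (abs_sum_le_sum_abs _ _).trans (sum_le_sum fun k hk => ?_)
        have hk' : a ≤ k := (mem_Ico.1 hk).1
        have h1 : (1 : ℝ) ≤ k := by exact_mod_cast ha.trans hk'
        rw [abs_mul]
        have h2 := mul_le_of_le_one_right (abs_nonneg (b k)) (w_le k)
        have h3 := le_mul_of_one_le_left (abs_nonneg (b k)) h1
        linarith [hb k hk']
    _ ≤ L * E := by
        rw [sum_const, Nat.card_Ico, nsmul_eq_mul]
        refine mul_le_mul_of_nonneg_right ?_ hE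
        exact_mod_cast (by omega : M - a ≤ L)

/-- Sums of `b` against the sine at a rational frequency. -/
lemma abs_sum_Ico_mul_sin_rational_le (r : ℕ) (hr : 3 ≤ r) (b : ℕ → ℝ) (E₁ E₂ : ℝ) (n : ℕ)
    (hn : 1 ≤ n) (hE₁ : 0 ≤ E₁) (hb : ∀ k, n ≤ k → (k : ℝ) * |b k| ≤ E₁)
    (hE₂ : ∀ p q, n ≤ r * p →
      ∑ m ∈ Ico p q, ∑ k ∈ Icc 1 (r / 2), |b (r * m + k) - b (r * m + r - k)| ≤ E₂)
    (l : ℤ) (M : ℕ) :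
    |∑ k ∈ Ico n M, b k * Real.sin (k * (2 * Real.pi * l / r))| ≤ E₂ + 2 * r * E₁ := by
  have hr0 : (r : ℝ) ≠ 0 := by positivity
  set s : ℕ → ℝ := fun k => Real.sin (k * (2 * Real.pi * l / r)) with hs
  have s_le (j) : |s j| ≤ 1 := Real.abs_sin_le_one _
  have s_per (m j) : s (r * m + j) = s j := by
    simp only [hs]
    rw [← Real.sin_add_int_mul_two_pi _ (-(m * l))]
    congr 1
    push_cast
    field_simp
    ring
  have s_anti (j) (hj : j ≤ r) : s (r - j) = - s j := by
    simp only [hs]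
    rw [← Real.sin_neg, ← Real.sin_add_int_mul_two_pi (-_) l]
    congr 1
    push_cast [hj]
    field_simp
    ring
  change |∑ k ∈ Ico n M, b k * s k| ≤ _
  have hE₂0 : 0 ≤ E₂ := by
    have := hE₂ n n (by nlinarith)
    simpa using this
  obtain ⟨p, hp1, hp2⟩ : ∃ p, n ≤ r * p ∧ r * p ≤ n + r := by
    refine ⟨n / r + 1, ?_, ?_⟩
    · rw [mul_add, mul_one]; exact (Nat.lt_mul_div_succ n (by omega)).le
    · rw [mul_add, mul_one]; exact Nat.add_le_add_right (Nat.mul_div_le n r) r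
  obtain ⟨q, hq1, hq2⟩ : ∃ q, r * q ≤ M ∧ M ≤ r * q + r :=
    ⟨M / r, Nat.mul_div_le M r, (Nat.lt_mul_div_succ M (by omega)).le⟩
  rcases le_total q p with h | h
  · have h1 := Nat.mul_le_mul_left r h
    have := abs_sum_Ico_mul_le_card b s E₁ n M (2 * r) hn (by omega) hE₁ hb s_le
    push_cast at this
    linarith
  · have h1 := Nat.mul_le_mul_left r h
    rw [← sum_Ico_consecutive _ hp1 (h1.trans hq1), ← sum_Ico_consecutive _ h1 hq1]
    have hA := abs_sum_Ico_mul_le_card b s E₁ n (r * p) r hn hp2 hE₁ hb s_le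
    have hC := abs_sum_Ico_mul_le_card b s E₁ (r * q) M r (by omega) hq2 hE₁
      (fun k hk => hb k (by omega)) s_le
    have hB : |∑ k ∈ Ico (r * p) (r * q), b k * s k| ≤ E₂ := by
      rw [sum_Ico_mul_eq_sum_blocks r p q h]
      refine ((abs_sum_le_sum_abs _ _).trans (sum_le_sum fun m _ => ?_)).trans (hE₂ p q hp1)
      simp only [s_per]
      refine (abs_sum_range_mul_le_of_antisymm r (by omega) (fun j => b (r * m + j)) s
        (by simp [hs]) s_le s_anti).trans (le_of_eq (sum_congr rfl fun j hj => ?_))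
      have : r * m + (r - j) = r * m + r - j := by simp at hj; omega
      rw [this]
    have t1 := abs_add_le (∑ k ∈ Ico n (r * p), b k * s k)
      (∑ k ∈ Ico (r * p) (r * q), b k * s k + ∑ k ∈ Ico (r * q) M, b k * s k)
    have t2 := abs_add_le (∑ k ∈ Ico (r * p) (r * q), b k * s k) (∑ k ∈ Ico (r * q) M, b k * s k)
    linarith

/-- Sums of `b` against the sine at a frequency close to a rational one. -/
lemma abs_sum_Ico_mul_sin_near_rational_le (r : ℕ) (hr : 3 ≤ r) (b : ℕ → ℝ) (E₁ E₂ : ℝ) (n : ℕ)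
    (hn : 1 ≤ n) (hE₁ : 0 ≤ E₁) (hb : ∀ k, n ≤ k → (k : ℝ) * |b k| ≤ E₁)
    (hE₂ : ∀ p q, n ≤ r * p →
      ∑ m ∈ Ico p q, ∑ k ∈ Icc 1 (r / 2), |b (r * m + k) - b (r * m + r - k)| ≤ E₂)
    (l : ℤ) (t : ℝ) (M : ℕ) (hM : M * |t| ≤ 3) :
    |∑ k ∈ Ico n M, b k * Real.sin (k * (2 * Real.pi * l / r + t))| ≤ E₂ + (2 * r + 3) * E₁ := by
  have h1 := abs_sum_Ico_mul_sin_rational_le r hr b E₁ E₂ n hn hE₁ hb hE₂ l M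
  set y := 2 * Real.pi * l / r
  have h2 : |∑ k ∈ Ico n M, b k * (Real.sin (k * (y + t)) - Real.sin (k * y))| ≤ 3 * E₁ := by
    calc _ ≤ ∑ k ∈ Ico n M, E₁ * |t| := by
          refine (abs_sum_le_sum_abs _ _).trans (sum_le_sum fun k hk => ?_)
          have h3 : |Real.sin (k * (y + t)) - Real.sin (k * y)| ≤ k * |t| := by
            have h4 := Real.abs_sin_sub_sin_le (k * (y + t)) (k * y)
            have h5 : (k : ℝ) * (y + t) - k * y = k * t := by ring
            rwa [h5, abs_mul, Nat.abs_cast] at h4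
          rw [abs_mul]
          calc _ ≤ |b k| * (k * |t|) := by gcongr
            _ = (k * |b k|) * |t| := by ring
            _ ≤ E₁ * |t| := by gcongr; exact hb k (mem_Ico.1 hk).1
      _ = ((M - n : ℕ) : ℝ) * |t| * E₁ := by
          rw [sum_const, Nat.card_Ico, nsmul_eq_mul]; ring
      _ ≤ M * |t| * E₁ := by gcongr; omega
      _ ≤ 3 * E₁ := by gcongr
  have h3 : ∑ k ∈ Ico n M, b k * Real.sin (k * (y + t)) =
      ∑ k ∈ Ico n M, b k * (Real.sin (k * (y + t)) - Real.sin (k * y)) +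
      ∑ k ∈ Ico n M, b k * Real.sin (k * y) := by
    rw [← sum_add_distrib]
    exact sum_congr rfl fun k _ => by ring
  rw [h3]
  refine (abs_add_le _ _).trans ?_
  linarith

/-- Dyadic summation: decay of dyadic blocks passes to arbitrary tails. -/
lemma sum_Ico_le_of_dyadic (g : ℕ → ℝ) (hg : ∀ k, 0 ≤ g k) (D : ℝ) (hD : 0 ≤ D) (N : ℕ)
    (hN : 1 ≤ N) (h : ∀ m, N ≤ m → ∑ k ∈ Ico m (2 * m), g k ≤ D / m) (M : ℕ) :
    ∑ k ∈ Ico N M, g k ≤ 2 * D / N := by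
  have hN0 : (0 : ℝ) < N := by exact_mod_cast hN
  have key (j : ℕ) : ∑ k ∈ Ico N (2 ^ j * N), g k ≤ 2 * D / N * (1 - (1 / 2) ^ j) := by
    induction j with
    | zero => simp
    | succ j ih =>
      have h1 : N ≤ 2 ^ j * N := Nat.le_mul_of_pos_left N (by positivity)
      have h2 := h (2 ^ j * N) h1
      have h3 : 2 ^ (j + 1) * N = 2 * (2 ^ j * N) := by ring
      rw [h3, ← sum_Ico_consecutive g h1 (by omega)]
      have h4 : D / ((2 ^ j * N : ℕ) : ℝ) = D / N * (1 / 2) ^ j := by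
        push_cast
        field_simp
        rw [mul_assoc, ← mul_pow]; norm_num
      rw [h4] at h2
      have h5 : 2 * D / N * (1 - (1 / 2) ^ (j + 1)) =
        2 * D / N * (1 - (1 / 2) ^ j) + D / N * (1 / 2) ^ j := by ring
      linarith
  have h1 : M ≤ 2 ^ M * N := Nat.lt_two_pow_self.le.trans (Nat.le_mul_of_pos_right _ hN)
  calc ∑ k ∈ Ico N M, g k ≤ ∑ k ∈ Ico N (2 ^ M * N), g k :=
        sum_le_sum_of_subset_of_nonneg (Ico_subset_Ico_right h1) fun k _ _ => hg k
    _ ≤ 2 * D / N * (1 - (1 / 2) ^ M) := key M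
    _ ≤ 2 * D / N := mul_le_of_le_one_right (by positivity) (by
        have : (0 : ℝ) ≤ (1 / 2) ^ M := by positivity
        linarith)

/-- The class condition bounds the dyadic variation by the size of `k * |b k|`. -/
lemma gm_dyadic_bound (r : ℕ) (b : ℕ → ℝ) (K c : ℝ) (hK : 0 < K) (hc : 1 < c)
    (hgm : ∀ m : ℕ, 1 ≤ m →
      (∑ n ∈ Finset.Icc m (2 * m - 1), |b n - b (n + r)|) ≤
        K * ((∑ k ∈ Finset.Icc m (m + r - 1), |b k|) +
          ∑ k ∈ Finset.Icc (max 1 ⌊(m : ℝ) / c⌋₊) ⌊c * (m : ℝ)⌋₊, |b k| / (k : ℝ)))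
    (E : ℝ) (n : ℕ) (hE : 0 ≤ E)
    (hb : ∀ k : ℕ, (n : ℝ) / c ≤ k → (k : ℝ) * |b k| ≤ E) (m : ℕ) (hm : 1 ≤ m)
    (hnm : n + c ≤ m) :
    ∑ k ∈ Ico m (2 * m), |b k - b (k + r)| ≤ (K * (r + 4 * c ^ 3) * E) / m := by
  have hc0 : 0 < c := by linarith
  have hm0 : (0 : ℝ) < m := by exact_mod_cast hm
  have hncm : (n : ℝ) / c ≤ m / c - 1 := by
    rw [div_sub_one hc0.ne']; gcongr; linarith
  have e1 : Icc m (2 * m - 1) = Ico m (2 * m) := by ext; simp; omega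
  have e2 : Icc m (m + r - 1) = Ico m (m + r) := by ext; simp; omega
  have h0 := hgm m hm
  rw [e1, e2] at h0
  have h1 : ∑ k ∈ Ico m (m + r), |b k| ≤ r * E / m := by
    calc _ ≤ ∑ k ∈ Ico m (m + r), E / m := by
          refine sum_le_sum fun k hk => ?_
          have hk' : (m : ℝ) ≤ k := by exact_mod_cast (mem_Ico.1 hk).1
          rw [le_div_iff₀ hm0]
          have : (m : ℝ) / c ≤ m := div_le_self hm0.le hc.le
          have := hb k (by linarith)
          nlinarith [abs_nonneg (b k)]
      _ = r * E / m := by simp; ring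
  have h2 : ∑ k ∈ Icc (max 1 ⌊(m : ℝ) / c⌋₊) ⌊c * (m : ℝ)⌋₊, |b k| / (k : ℝ) ≤
      4 * c ^ 3 * E / m := by
    calc _ ≤ ∑ k ∈ Icc (max 1 ⌊(m : ℝ) / c⌋₊) ⌊c * (m : ℝ)⌋₊, 4 * c ^ 2 * E / m ^ 2 := by
          refine sum_le_sum fun k hk => ?_
          have hk := (mem_Icc.1 hk).1
          have hk1 : (1 : ℝ) ≤ k := by exact_mod_cast (le_max_left _ _).trans hk
          have hk2 : ((⌊(m : ℝ) / c⌋₊ : ℕ) : ℝ) ≤ k := by exact_mod_cast (le_max_right _ _).trans hk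
          have hk3 := Nat.lt_floor_add_one ((m : ℝ) / c)
          have hk4 := hb k (by linarith)
          have hk5 : (m : ℝ) ≤ 2 * c * k := by
            have : (m : ℝ) / c ≤ 2 * k := by linarith
            rw [div_le_iff₀ hc0] at this
            linarith
          rw [div_le_div_iff₀ (by linarith) (by positivity)]
          calc |b k| * (m : ℝ) ^ 2 ≤ |b k| * (2 * c * k) ^ 2 := by gcongr
            _ = 4 * c ^ 2 * (k * |b k|) * k := by ring
            _ ≤ 4 * c ^ 2 * E * k := by gcongr
      _ ≤ c * m * (4 * c ^ 2 * E / m ^ 2) := by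
          rw [sum_const, nsmul_eq_mul, Nat.card_Icc]
          refine mul_le_mul_of_nonneg_right ?_ (by positivity)
          refine le_trans ?_ (Nat.floor_le (by positivity : 0 ≤ c * (m : ℝ)))
          have := le_max_left 1 ⌊(m : ℝ) / c⌋₊
          exact_mod_cast (by omega)
      _ = 4 * c ^ 3 * E / m := by field_simp
  calc _ ≤ _ := h0
    _ ≤ K * (r * E / m + 4 * c ^ 3 * E / m) := by gcongr
    _ = _ := by ring

/-- Summation by parts with step `r`. -/
lemma abs_sin_mul_abs_sum_Ico_le (r : ℕ) (b : ℕ → ℝ) (x B V : ℝ) (N M : ℕ)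
    (hB : ∀ k, N ≤ k → |b k| ≤ B) (hV : ∑ k ∈ Ico N M, |b k - b (k + r)| ≤ V) :
    2 * |Real.sin (r * x / 2)| * |∑ k ∈ Ico N M, b k * Real.sin (k * x)| ≤ V + 2 * r * B := by
  set C : ℕ → ℝ := fun k => Real.cos (((k : ℝ) - r / 2) * x) with hC
  have C_le (k) : |C k| ≤ 1 := Real.abs_cos_le_one _
  have hB0 : 0 ≤ B := (abs_nonneg _).trans (hB N le_rfl)
  have hsin (k : ℕ) : 2 * Real.sin (r * x / 2) * Real.sin (k * x) = C k - C (k + r) := by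
    simp only [hC]
    push_cast
    have e1 : ((k : ℝ) - r / 2) * x = k * x - r * x / 2 := by ring
    have e2 : ((k : ℝ) + r - r / 2) * x = k * x + r * x / 2 := by ring
    rw [e1, e2, Real.cos_sub, Real.cos_add]
    ring
  have hid : 2 * Real.sin (r * x / 2) * ∑ k ∈ Ico N M, b k * Real.sin (k * x) =
      ∑ k ∈ Ico N M, (b k * C k - b (k + r) * C (k + r)) -
        ∑ k ∈ Ico N M, (b k - b (k + r)) * C (k + r) := by
    rw [mul_sum, ← sum_sub_distrib]
    refine sum_congr rfl fun k _ => ?_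
    have := hsin k
    linear_combination b k * this
  have bC_le (k) (hk : N ≤ k) : |b k * C k| ≤ B := by
    rw [abs_mul]
    exact (mul_le_of_le_one_right (abs_nonneg _) (C_le k)).trans (hB k hk)
  have h1 : |∑ k ∈ Ico N M, (b k * C k - b (k + r) * C (k + r))| ≤ 2 * r * B := by
    rw [sum_Ico_eq_sum_range]
    have := sum_range_sub_shift (fun i => b (N + i) * C (N + i)) (M - N) r
    simp only [← Nat.add_assoc] at this
    rw [this]
    calc _ ≤ ∑ i ∈ range r, (B + B) := by
          refine (abs_sum_le_sum_abs _ _).trans (sum_le_sum fun i _ => ?_)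
          exact (abs_sub _ _).trans (add_le_add (bC_le _ (by omega)) (bC_le _ (by omega)))
      _ = 2 * r * B := by simp; ring
  have h2 : |∑ k ∈ Ico N M, (b k - b (k + r)) * C (k + r)| ≤ V := by
    refine ((abs_sum_le_sum_abs _ _).trans (sum_le_sum fun k _ => ?_)).trans hV
    rw [abs_mul]
    exact mul_le_of_le_one_right (abs_nonneg _) (C_le _)
  have h3 : 2 * |Real.sin (r * x / 2)| * |∑ k ∈ Ico N M, b k * Real.sin (k * x)| =
      |2 * Real.sin (r * x / 2) * ∑ k ∈ Ico N M, b k * Real.sin (k * x)| := by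
    rw [abs_mul, abs_mul]; norm_num
  rw [h3, hid]
  refine (abs_sub _ _).trans ?_
  linarith

lemma exists_near_rational_frequency (r : ℕ) (hr : 3 ≤ r) (x : ℝ) :
    ∃ (l : ℤ) (t : ℝ), x = 2 * Real.pi * l / r + t ∧ |t| ≤ 2 ∧
      |t| / 2 ≤ |Real.sin (r * x / 2)| := by
  have hr3 : (3 : ℝ) ≤ r := by exact_mod_cast hr
  have hr0 : (0 : ℝ) < r := by linarith
  have hpi := Real.pi_pos
  have hpi4 := Real.pi_le_four
  set l := round (r * x / (2 * Real.pi)) with hl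
  refine ⟨l, x - 2 * Real.pi * l / r, by ring, ?_⟩
  set t := x - 2 * Real.pi * l / r with ht
  have h1 : r * |t| ≤ Real.pi := by
    have h2 := abs_sub_round (r * x / (2 * Real.pi))
    rw [← hl] at h2
    have h3 : r * t = (2 * Real.pi) * (r * x / (2 * Real.pi) - l) := by
      rw [ht]; field_simp
    rw [← abs_of_pos hr0, ← abs_mul, h3, abs_mul, abs_of_pos (by positivity : 0 < 2 * Real.pi)]
    nlinarith
  have h4 : |Real.sin (r * x / 2)| = |Real.sin (r * t / 2)| := by
    have : r * x / 2 = r * t / 2 + l * Real.pi := by rw [ht]; field_simp; ring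
    rw [this, Real.sin_add_int_mul_pi, abs_mul, abs_zpow, abs_neg, abs_one, one_zpow, one_mul]
  have ht0 := abs_nonneg t
  refine ⟨by nlinarith, ?_⟩
  have h5 : |r * t / 2| = r * |t| / 2 := by rw [abs_div, abs_mul, abs_of_pos hr0]; norm_num
  have h6 := Real.mul_abs_le_abs_sin (x := r * t / 2) (by rw [h5]; linarith)
  rw [h4]
  refine le_trans ?_ h6
  rw [h5, div_mul_eq_mul_div, le_div_iff₀ hpi]
  nlinarith

/-- Uniform bound for finite sections of the tail. -/
lemma gm_section_bound (r : ℕ) (hr : 3 ≤ r) (b : ℕ → ℝ) (K c : ℝ) (hK : 0 < K) (hc : 1 < c)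
    (hgm : ∀ m : ℕ, 1 ≤ m →
      (∑ n ∈ Finset.Icc m (2 * m - 1), |b n - b (n + r)|) ≤
        K * ((∑ k ∈ Finset.Icc m (m + r - 1), |b k|) +
          ∑ k ∈ Finset.Icc (max 1 ⌊(m : ℝ) / c⌋₊) ⌊c * (m : ℝ)⌋₊, |b k| / (k : ℝ))) :
    ∃ C : ℝ, 0 < C ∧ ∀ n : ℕ, 1 ≤ n → ∀ E₁ E₂ : ℝ, 0 ≤ E₁ →
      (∀ k : ℕ, (n : ℝ) / c ≤ k → (k : ℝ) * |b k| ≤ E₁) →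
      (∀ p q, n ≤ r * p →
        ∑ m ∈ Ico p q, ∑ k ∈ Icc 1 (r / 2), |b (r * m + k) - b (r * m + r - k)| ≤ E₂) →
      ∀ (x : ℝ) (M : ℕ), |∑ k ∈ Ico n M, b k * Real.sin (k * x)| ≤ C * (E₁ + E₂) := by
  have hc0 : 0 < c := by linarith
  set D : ℝ := K * (r + 4 * c ^ 3) with hD
  have hD0 : 0 < D := by positivity
  set L : ℕ := ⌈c⌉₊ with hL
  refine ⟨2 * r + 3 + L + 2 * (D + r), by positivity, fun n hn E₁ E₂ hE₁ hb hE₂ x M => ?_⟩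
  have hE₂0 : 0 ≤ E₂ := by
    have := hE₂ n n (by nlinarith)
    simpa using this
  have hbn (k : ℕ) (hk : n ≤ k) : (k : ℝ) * |b k| ≤ E₁ := by
    refine hb k ((div_le_self (by positivity) hc.le).trans ?_)
    exact_mod_cast hk
  obtain ⟨l, t, hx, ht2, hsin⟩ := exists_near_rational_frequency r hr x
  have near (M : ℕ) (hM : M * |t| ≤ 3) :
      |∑ k ∈ Ico n M, b k * Real.sin (k * x)| ≤ E₂ + (2 * r + 3) * E₁ := by
    rw [hx]
    exact abs_sum_Ico_mul_sin_near_rational_le r hr b E₁ E₂ n hn hE₁ hbn hE₂ l t M hM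
  have far (N : ℕ) (hN : n + L ≤ N) (hNt : 1 ≤ N * |t|) (M : ℕ) :
      |∑ k ∈ Ico N M, b k * Real.sin (k * x)| ≤ 2 * (D + r) * E₁ := by
    have hN0 : (0 : ℝ) < N := by exact_mod_cast (by omega : 0 < N)
    have hcN : n + c ≤ N := by
      have h1 : c ≤ L := Nat.le_ceil c
      have h2 : (n : ℝ) + L ≤ N := by exact_mod_cast hN
      linarith
    have hV := sum_Ico_le_of_dyadic (fun k => |b k - b (k + r)|) (fun _ => abs_nonneg _)
      (D * E₁) (by positivity) N (by omega) (fun m hm =>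
        gm_dyadic_bound r b K c hK hc hgm E₁ n hE₁ hb m (by omega)
          (hcN.trans (by exact_mod_cast hm))) M
    have hB (k : ℕ) (hk : N ≤ k) : |b k| ≤ E₁ / N := by
      rw [le_div_iff₀ hN0]
      have : (N : ℝ) ≤ k := by exact_mod_cast hk
      have := hbn k (by omega)
      nlinarith [abs_nonneg (b k)]
    have key := abs_sin_mul_abs_sum_Ico_le r b x (E₁ / N) _ N M hB hV
    set F := |∑ k ∈ Ico N M, b k * Real.sin (k * x)|
    have hF : 0 ≤ F := abs_nonneg _
    have e : 2 * (D * E₁) / N + 2 * r * (E₁ / N) = 2 * (D + r) * E₁ / N := by ring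
    rw [e, le_div_iff₀ hN0] at key
    have h1 : 1 ≤ 2 * |Real.sin (r * x / 2)| * N := by nlinarith
    calc F ≤ 2 * |Real.sin (r * x / 2)| * N * F := le_mul_of_one_le_left hF h1
      _ = 2 * |Real.sin (r * x / 2)| * F * N := by ring
      _ ≤ _ := key
  have far' (P : ℕ) (hP : n ≤ P) (hPt : 1 ≤ P * |t|) (M : ℕ) :
      |∑ k ∈ Ico P M, b k * Real.sin (k * x)| ≤ (L + 2 * (D + r)) * E₁ := by
    have short (M : ℕ) (hM : M ≤ P + L) := abs_sum_Ico_mul_le_card b (fun k => Real.sin (k * x))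
      E₁ P M L (by omega) hM hE₁ (fun k hk => hbn k (by omega)) fun k => Real.abs_sin_le_one _
    have h0 : 0 ≤ 2 * (D + r) * E₁ := by positivity
    rcases le_total M (P + L) with h | h
    · linarith [short M h]
    · have h1 := short (P + L) le_rfl
      have h2 := far (P + L) (by omega) (hPt.trans (by gcongr; omega)) M
      rw [← sum_Ico_consecutive _ (by omega) h]
      refine (abs_add_le _ _).trans ?_
      linarith
  have hfin : E₂ + (2 * r + 3) * E₁ + (L + 2 * (D + r)) * E₁ ≤
      (2 * r + 3 + L + 2 * (D + r)) * (E₁ + E₂) := by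
    have : 0 ≤ (2 * r + 2 + L + 2 * (D + r)) * E₂ := by positivity
    linarith
  have hnear0 : 0 ≤ E₂ + (2 * r + 3) * E₁ := by positivity
  have hfar0 : 0 ≤ (L + 2 * (D + r)) * E₁ := by positivity
  refine le_trans ?_ hfin
  rcases eq_or_ne t 0 with ht | ht
  · linarith [near M (by rw [ht]; simp)]
  have ht0 : 0 < |t| := abs_pos.2 ht
  set T : ℕ := ⌊1 / |t|⌋₊ + 1 with hT
  have hT1 : 1 ≤ T * |t| := by
    have := Nat.lt_floor_add_one (1 / |t|)
    rw [div_lt_iff₀ ht0] at this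
    push_cast [hT]
    exact this.le
  have hT3 : T * |t| ≤ 3 := by
    have := Nat.floor_le (by positivity : 0 ≤ 1 / |t|)
    rw [le_div_iff₀ ht0] at this
    push_cast [hT]
    linarith
  rcases le_total M T with hMT | hMT
  · have := near M (le_trans (by gcongr) hT3)
    linarith
  rcases le_total n T with hnT | hnT
  · rw [← sum_Ico_consecutive _ hnT hMT]
    refine (abs_add_le _ _).trans ?_
    exact add_le_add (near T hT3) (far' T hnT hT1 M)
  · have := far' n le_rfl (hT1.trans (by gcongr)) M
    linarith

theorem tail_estimate_gm_star_r
    (r : ℕ) (hr : 3 ≤ r) (b : ℕ → ℝ) (K c : ℝ) (hK : 0 < K) (hc : 1 < c)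
    (hgm : ∀ m : ℕ, 1 ≤ m →
      (∑ n ∈ Finset.Icc m (2 * m - 1), |b n - b (n + r)|) ≤
        K * ((∑ k ∈ Finset.Icc m (m + r - 1), |b k|) +
          ∑ k ∈ Finset.Icc (max 1 ⌊(m : ℝ) / c⌋₊) ⌊c * (m : ℝ)⌋₊, |b k| / (k : ℝ)))
    (hto : Tendsto (fun n : ℕ => (n : ℝ) * |b n|) atTop (nhds 0))
    (hsum : Summable (fun n : ℕ =>
      ∑ k ∈ Finset.Icc 1 (r / 2), |b (r * n + k) - b (r * n + r - k)|)) :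
    ∃ rn : ℕ → ℝ → ℝ,
      (∀ n : ℕ, ∀ x : ℝ,
        Tendsto (fun N : ℕ => ∑ k ∈ Finset.Icc n N, b k * Real.sin (k * x)) atTop
          (nhds (rn n x))) ∧
      ∃ C : ℝ, 0 < C ∧ ∀ n : ℕ, 1 ≤ n → ∀ x : ℝ,
        |rn n x| ≤ C *
          (sSup {y : ℝ | ∃ k : ℕ, (n : ℝ) / c ≤ (k : ℝ) ∧ y = (k : ℝ) * |b k|} +
            ∑' m : ℕ, if (n : ℝ) / (r : ℝ) ≤ (m : ℝ) then
              ∑ k ∈ Finset.Icc 1 (r / 2), |b (r * m + k) - b (r * m + r - k)| else 0) := by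
  have hc0 : 0 < c := by linarith
  have hr0 : (0 : ℝ) < r := by positivity
  obtain ⟨C, hC, hbound⟩ := gm_section_bound r hr b K c hK hc hgm
  set A : ℕ → ℝ := fun m => ∑ k ∈ Icc 1 (r / 2), |b (r * m + k) - b (r * m + r - k)| with hA
  have hA0 (m) : 0 ≤ A m := sum_nonneg fun _ _ => abs_nonneg _
  have hcauchy (x : ℝ) : CauchySeq fun M => ∑ k ∈ range M, b k * Real.sin (k * x) := by
    rw [Metric.cauchySeq_iff']
    intro δ hδ
    set η := δ / (4 * C) with hη
    have hη0 : 0 < η := by positivity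
    obtain ⟨k₀, hk₀⟩ := eventually_atTop.1 (hto.eventually_le_const hη0)
    obtain ⟨p₀, hp₀⟩ := eventually_atTop.1
      (hsum.hasSum.tendsto_sum_nat.eventually_const_le (sub_lt_self (∑' m, A m) hη0))
    obtain ⟨n, hn⟩ := exists_nat_ge (c * k₀ + r * p₀ + 1)
    have hck : 0 ≤ c * k₀ := by positivity
    have hrp : 0 ≤ (r : ℝ) * p₀ := by positivity
    have hn1 : 1 ≤ n := by exact_mod_cast (by linarith : (1 : ℝ) ≤ n)
    refine ⟨n, fun M hM => ?_⟩
    have h := hbound n hn1 η η hη0.le (fun k hk => hk₀ k ?_) (fun p q hp => ?_) x M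
    · rw [Real.dist_eq, ← sum_Ico_eq_sub _ hM]
      have : C * (η + η) = δ / 2 := by rw [hη]; field_simp; norm_num
      linarith
    · rw [div_le_iff₀ hc0] at hk
      have : (k₀ : ℝ) ≤ k := by nlinarith
      exact_mod_cast this
    · change ∑ m ∈ Ico p q, A m ≤ η
      rcases le_total q p with hqp | hpq
      · rw [Ico_eq_empty_of_le hqp]; simpa using hη0.le
      rw [sum_Ico_eq_sub _ hpq]
      have h1 := hsum.sum_le_tsum (range q) fun m _ => hA0 m
      have h2 := hp₀ p (by
        have h3 : (n : ℝ) ≤ r * p := by exact_mod_cast hp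
        have : (p₀ : ℝ) ≤ p := by nlinarith
        exact_mod_cast this)
      linarith
  choose S hS using fun x => cauchySeq_tendsto_of_complete (hcauchy x)
  refine ⟨fun n x => S x - ∑ k ∈ range n, b k * Real.sin (k * x), ?_⟩
  have hlim (n : ℕ) (x : ℝ) : Tendsto (fun N : ℕ => ∑ k ∈ Icc n N, b k * Real.sin (k * x)) atTop
      (nhds (S x - ∑ k ∈ range n, b k * Real.sin (k * x))) := by
    have h := ((tendsto_add_atTop_iff_nat 1).2 (hS x)).sub_const
      (∑ k ∈ range n, b k * Real.sin (k * x))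
    refine h.congr' ?_
    filter_upwards [eventually_ge_atTop n] with N hN
    rw [← sum_Ico_eq_sub _ (by omega)]
    congr 1
  refine ⟨hlim, C, hC, fun n hn x => le_of_tendsto (hlim n x).abs (Eventually.of_forall fun N => ?_)⟩
  have hbdd : BddAbove {y : ℝ | ∃ k : ℕ, (n : ℝ) / c ≤ (k : ℝ) ∧ y = (k : ℝ) * |b k|} :=
    hto.bddAbove_range.mono (by rintro y ⟨k, _, rfl⟩; exact ⟨k, rfl⟩)
  have e : Icc n N = Ico n (N + 1) := by ext; simp
  rw [e]
  refine hbound n hn _ _ (Real.sSup_nonneg ?_) (fun k hk => le_csSup hbdd ⟨k, hk, rfl⟩)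
    (fun p q hp => ?_) x _
  · rintro y ⟨k, _, rfl⟩
    positivity
  · change ∑ m ∈ Ico p q, A m ≤ ∑' m : ℕ, if (n : ℝ) / r ≤ m then A m else 0
    have hite (m : ℕ) : 0 ≤ if (n : ℝ) / r ≤ m then A m else 0 := by
      split_ifs
      exacts [hA0 m, le_rfl]
    have hs : Summable fun m : ℕ => if (n : ℝ) / r ≤ m then A m else 0 :=
      hsum.of_nonneg_of_le hite fun m => by
        split_ifs
        exacts [le_rfl, hA0 m]
    refine le_trans (le_of_eq (sum_congr rfl fun m hm => ?_))
      (hs.sum_le_tsum (Ico p q) fun m _ => hite m)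
    rw [if_pos]
    rw [div_le_iff₀ hr0, mul_comm]
    exact_mod_cast hp.trans (Nat.mul_le_mul_left r (mem_Ico.1 hm).1)
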